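/- Let σ > -1 and λ = d+1+σ. For every norm |·| on ℂ^{d̃} satisfying |conj(Z)| = |Z|, and for every measurable G on B with ‖G‖_∞ ≤ 1, the Bloch seminorm of T_σ G satisfies ‖T_σ G‖_𝓑 = sup_{z∈B} (1-|z|²)^n |D_z(T_σ G)(z)| ≤ 𝓒 · Γ(λ+n)Γ(n) / Γ((λ+n)/2)², where 𝓒 = max_{|ζ|=1} |Z(ζ)|. -/

import Mathlib

open MeasureTheory Complex Metric
open scoped ENNReal Classical

noncomputable section

abbrev Cd (d : ℕ) : Type := EuclideanSpace ℂ (Fin d)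

instance (d : ℕ) : MeasurableSpace (Cd d) := borel _
instance (d : ℕ) : BorelSpace (Cd d) := ⟨rfl⟩
noncomputable instance (d : ℕ) : MeasureSpace (Cd d) := measureSpaceOfInnerProductSpace

/-- The open unit ball of `ℂ^d`. -/
def unitBall (d : ℕ) : Set (Cd d) := Metric.ball 0 1

/-- Lebesgue measure on `ℂ^d`, normalized so that the unit ball has measure one. -/
def normVol (d : ℕ) : Measure (Cd d) := (volume (unitBall d))⁻¹ • volume

/-- The inner product `⟨z,w⟩ = ∑ z_j conj (w_j)`. -/
def herm {d : ℕ} (z w : Cd d) : ℂ := ∑ j, z j * (starRingEnd ℂ) (w j)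

/-- The normalizing constant `c_σ`. -/
def cCoef (d : ℕ) (σ : ℝ) : ℝ :=
  Real.Gamma (d + σ + 1) / (Real.Gamma (σ + 1) * Real.Gamma (d + 1))

/-- The Bergman kernel `K_σ(z,w) = (1-|w|²)^σ / (1-⟨z,w⟩)^{d+1+σ}`. -/
def bergKer (d : ℕ) (σ : ℝ) (z w : Cd d) : ℂ :=
  (((1 - ‖w‖ ^ 2 : ℝ) ^ σ : ℝ) : ℂ) / (1 - herm z w) ^ ((((d : ℝ) + 1 + σ : ℝ)) : ℂ)

/-- The Bergman projection `T_σ f (z) = c_σ ∫_B K_σ(z,w) f(w) dv(w)`. -/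
def bergman (d : ℕ) (σ : ℝ) (f : Cd d → ℂ) (z : Cd d) : ℂ :=
  (cCoef d σ : ℂ) * ∫ w in unitBall d, bergKer d σ z w * f w ∂(normVol d)

/-- The complex partial derivative `∂/∂z_j`. -/
def pd (d : ℕ) (j : Fin d) (f : Cd d → ℂ) : Cd d → ℂ :=
  fun z => fderiv ℂ f z (EuclideanSpace.single j 1)

/-- The complex partial derivative `∂^α` for a multi-index `α`. -/
def mpd (d : ℕ) (α : Fin d → ℕ) (f : Cd d → ℂ) : Cd d → ℂ :=
  (List.finRange d).foldr (fun j g => (pd d j)^[α j] g) f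

/-- Multi-indices `α ∈ ℤ₊^d` with `|α| = n`; there are `d̃ = (n+d-1).choose (d-1)` of them. -/
def MIdx (d n : ℕ) : Type := {α : Fin d → ℕ // ∑ j, α j = n}

instance (d n : ℕ) : Fintype (MIdx d n) :=
  Fintype.subtype (Finset.Nat.antidiagonalTuple d n)
    (fun _ => Finset.Nat.mem_antidiagonalTuple)

/-- `𝒟_z f (z) = (∂^α f(z))_{|α|=n} ∈ ℂ^{d̃}`. -/
def Dmap (d n : ℕ) (f : Cd d → ℂ) (z : Cd d) : MIdx d n → ℂ := fun α => mpd d α.1 f z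

/-- `Z(ζ) = (ζ^α)_{|α|=n} ∈ ℂ^{d̃}`. -/
def Zmap (d n : ℕ) (ζ : Cd d) : MIdx d n → ℂ := fun α => ∏ j, ζ j ^ α.1 j

/-- The Bloch seminorm `‖f‖_𝓑 = sup_{z∈B} (1-|z|²)^n |𝒟_z f(z)|` w.r.t. a norm `N` on `ℂ^{d̃}`. -/
def blochSemi (d n : ℕ) (N : (MIdx d n → ℂ) → ℝ) (f : Cd d → ℂ) : ℝ :=
  ⨆ z : unitBall d, (1 - ‖(z : Cd d)‖ ^ 2) ^ n * N (Dmap d n f z)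

/-- The seminorm of `T_σ : L^∞(B) → 𝓑`, i.e. `sup_{‖G‖_∞ ≤ 1} ‖T_σ G‖_𝓑`. -/
def opSemi (d n : ℕ) (σ : ℝ) (N : (MIdx d n → ℂ) → ℝ) : ℝ :=
  ⨆ G : {G : Cd d → ℂ // Measurable G ∧ ∀ w, ‖G w‖ ≤ 1},
    blochSemi d n N (bergman d σ G.1)

/-- `𝓒 = max_{|ζ|=1} |Z(ζ)|`. -/
def maxC (d n : ℕ) (N : (MIdx d n → ℂ) → ℝ) : ℝ :=
  ⨆ ζ : Metric.sphere (0 : Cd d) 1, N (Zmap d n (ζ : Cd d))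

/-- The Möbius automorphism `φ_z` of the unit ball, with `φ_0 = -id`. -/
def moebius (d : ℕ) (z ω : Cd d) : Cd d :=
  if z = 0 then -ω
  else (1 - herm ω z)⁻¹ •
    (z - (herm ω z / ((‖z‖ ^ 2 : ℝ) : ℂ)) • z
       - ((Real.sqrt (1 - ‖z‖ ^ 2) : ℝ) : ℂ) • (ω - (herm ω z / ((‖z‖ ^ 2 : ℝ) : ℂ)) • z))

end


/-- binomial coefficients of `(1-x)^{-a}` -/
noncomputable def bc (a : ℝ) (k : ℕ) : ℝ := Real.Gamma (a + k) / (Real.Gamma a * k.factorial)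

lemma bc_pos {a : ℝ} (ha : 0 < a) (k : ℕ) : 0 < bc a k := by
  unfold bc
  have := Real.Gamma_pos_of_pos ha
  have := Real.Gamma_pos_of_pos (show 0 < a + k by positivity)
  positivity

lemma ring_choose_eq_bc {a : ℝ} (ha : 0 < a) (k : ℕ) : Ring.choose (a + k - 1) k = bc a k := by
  have h1 : Ring.choose (a + k - 1) k = Ring.multichoose a k := by
    have := Ring.choose_neg (R := ℝ)
    rw [Ring.choose]
    congr 1
    ring
  rw [h1]
  have h2 := Ring.factorial_nsmul_multichoose_eq_ascPochhammer a k
  have h3 : ∀ k : ℕ, Real.Gamma (a + k) = Real.Gamma a * (ascPochhammer ℝ k).eval a := by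
    intro k
    induction k with
    | zero => simp
    | succ k ih =>
      rw [ascPochhammer_succ_eval, ← mul_assoc, ← ih]
      push_cast
      rw [← add_assoc, Real.Gamma_add_one (by positivity)]
      ring
  have h4 := Real.Gamma_pos_of_pos ha
  rw [Polynomial.ascPochhammer_smeval_eq_eval, nsmul_eq_mul] at h2
  unfold bc
  rw [h3, ← h2]
  field_simp

lemma hasSum_bc_complex {a : ℝ} (ha : 0 < a) {u : ℂ} (hu : ‖u‖ < 1) :
    HasSum (fun k : ℕ => (bc a k : ℂ) * u ^ k) ((1 - u) ^ (-(a : ℂ))) := by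
  have h := (one_div_one_sub_cpow_hasFPowerSeriesOnBall_zero (a : ℂ)).hasSum (y := u)
    (by simpa [enorm_eq_nnnorm] using! hu)
  simp only [FormalMultilinearSeries.ofScalars_apply_eq, zero_add] at h
  rw [one_div, ← cpow_neg] at h
  convert! h using 2 with k
  rw [← ring_choose_eq_bc ha, Complex.ofReal_choose]
  simp

lemma hasSum_bc_real {a : ℝ} (ha : 0 < a) {u : ℝ} (h0 : 0 ≤ u) (hu : u < 1) :
    HasSum (fun k : ℕ => bc a k * u ^ k) ((1 - u) ^ (-a)) := by
  have h := (Real.one_div_one_sub_rpow_hasFPowerSeriesOnBall_zero a).hasSum (y := u)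
    (by
      rw [Metric.mem_eball, edist_zero_right, ← ofReal_norm, Real.norm_of_nonneg h0]
      simpa using hu)
  simp only [FormalMultilinearSeries.ofScalars_apply_eq, zero_add] at h
  rw [one_div, ← Real.rpow_neg (by linarith)] at h
  convert! h using 2 with k
  rw [← ring_choose_eq_bc ha]
  simp

lemma gamma_sq_le {s t : ℝ} (hs : 0 < s) (ht : 0 < t) :
    Real.Gamma ((s + t) / 2) ^ 2 ≤ Real.Gamma s * Real.Gamma t := by
  have h := Real.Gamma_mul_add_mul_le_rpow_Gamma_mul_rpow_Gamma hs ht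
    (a := 1/2) (b := 1/2) (by norm_num) (by norm_num) (by norm_num)
  have hs' := Real.Gamma_pos_of_pos hs
  have ht' := Real.Gamma_pos_of_pos ht
  have e : (1/2 : ℝ) * s + 1/2 * t = (s + t)/2 := by ring
  rw [e, ← Real.sqrt_eq_rpow, ← Real.sqrt_eq_rpow] at h
  have hp := Real.Gamma_pos_of_pos (show 0 < (s+t)/2 by linarith)
  calc _ ≤ (√(Real.Gamma s) * √(Real.Gamma t)) ^ 2 := by gcongr
    _ = _ := by rw [mul_pow, Real.sq_sqrt hs'.le, Real.sq_sqrt ht'.le]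

/-- one-dimensional gaussian radial integral -/
lemma radial_gauss (m : ℕ) (hm : 0 < m) :
    ∫ y in Set.Ioi (0 : ℝ), y ^ (2 * m - 1) * Real.exp (-y ^ 2) = Real.Gamma m / 2 := by
  have h := _root_.integral_rpow_mul_exp_neg_rpow (p := 2) (q := (2 * m - 1 : ℕ)) (by norm_num)
    (lt_of_lt_of_le (by norm_num) (Nat.cast_nonneg _))
  have e : (((2 * m - 1 : ℕ) : ℝ) + 1) / 2 = m := by
    rw [Nat.cast_sub (by omega)]; push_cast; ring
  rw [e] at h
  simp only [Real.rpow_natCast, Real.rpow_ofNat] at h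
  rw [h]; ring

lemma beta_Ioo {m s : ℝ} (hm : 0 < m) (hs : -1 < s) :
    ∫ x in Set.Ioi (0 : ℝ), (Set.Iio 1).indicator (fun x => x ^ (m - 1) * (1 - x) ^ s) x =
      Real.Gamma m * Real.Gamma (s + 1) / Real.Gamma (m + s + 1) := by
  have h := Complex.betaIntegral_eq_Gamma_mul_div (m : ℂ) ((s + 1 : ℝ) : ℂ) (by simpa)
    (by simp; linarith)
  rw [Complex.betaIntegral, intervalIntegral.integral_of_le zero_le_one,
    integral_Ioc_eq_integral_Ioo] at h
  have e : ∫ x in Set.Ioo (0:ℝ) 1, ((x : ℂ) ^ ((m : ℂ) - 1) * (1 - (x : ℂ)) ^ (((s + 1 : ℝ) : ℂ) - 1))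
      = ∫ x in Set.Ioo (0:ℝ) 1, ((x ^ (m - 1) * (1 - x) ^ s : ℝ) : ℂ) := by
    refine setIntegral_congr_fun measurableSet_Ioo fun x hx => ?_
    rw [Complex.ofReal_mul, Complex.ofReal_cpow hx.1.le, Complex.ofReal_cpow (by linarith [hx.2])]
    push_cast
    congr 2
    ring
  rw [e, integral_complex_ofReal, Complex.Gamma_ofReal, Complex.Gamma_ofReal, ← Complex.ofReal_add,
    Complex.Gamma_ofReal, ← add_assoc] at h
  rw [setIntegral_indicator measurableSet_Iio, Set.Ioi_inter_Iio]
  exact_mod_cast h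

lemma radial_beta (m : ℕ) (hm : 0 < m) {s : ℝ} (hs : -1 < s) :
    ∫ y in Set.Ioi (0 : ℝ), y ^ (2 * m - 1) * (Set.Iio 1).indicator (fun y => (1 - y ^ 2) ^ s) y =
      Real.Gamma m * Real.Gamma (s + 1) / (2 * Real.Gamma (m + s + 1)) := by
  have h := beta_Ioo (m := m) (by exact_mod_cast hm) hs
  rw [← integral_comp_rpow_Ioi _ (p := 2) (by norm_num)] at h
  have : ∀ A B : ℝ, A / (2 * B) = 1/2 * (A / B) := by intro A B; rw [mul_comm 2 B, ← div_div]; ring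
  rw [this, ← h, ← integral_const_mul]
  refine setIntegral_congr_fun measurableSet_Ioi fun x hx => ?_
  have hx : 0 < x := hx
  have hi : x < 1 ↔ x ^ 2 < 1 := by rw [sq_lt_one_iff₀ hx.le]
  simp only [Set.indicator, Set.mem_Iio, Real.rpow_ofNat, hi]
  split_ifs
  · simp only [abs_two, smul_eq_mul]
    have : x ^ (2 * m - 1) = x ^ ((2:ℝ) - 1) * (x ^ 2) ^ ((m:ℝ) - 1) := by
      rw [← Real.rpow_natCast, ← Real.rpow_ofNat x 2, ← Real.rpow_mul hx.le, ← Real.rpow_add hx,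
        Nat.cast_sub (by omega)]
      congr 1
      push_cast; ring
    rw [this]; ring
  · simp


lemma finrank_Cd (d : ℕ) : Module.finrank ℝ (Cd d) = 2 * d := by
  have h1 := Module.finrank_mul_finrank ℝ ℂ (Cd d)
  rw [Complex.finrank_real_complex, finrank_euclideanSpace_fin] at h1
  rw [← h1]

lemma nontrivial_Cd {d : ℕ} (hd : 0 < d) : Nontrivial (Cd d) := by
  have : Nonempty (Fin d) := ⟨⟨0, hd⟩⟩
  infer_instance

lemma polar_homog {d : ℕ} (hd : 0 < d) (h : Cd d → ℝ) (k : ℕ)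
    (hh : ∀ (r : ℝ), 0 < r → ∀ x, h (r • x) = r ^ k * h x) (φ : ℝ → ℝ) :
    ∫ x, h x * φ ‖x‖ = (∫ s, h s ∂((volume : Measure (Cd d)).toSphere)) *
      ∫ y in Set.Ioi (0 : ℝ), y ^ (2 * d - 1) * (y ^ k * φ y) := by
  have := nontrivial_Cd hd
  let μ : Measure (Cd d) := volume
  calc
    ∫ x, h x * φ ‖x‖ = ∫ x : ({(0)}ᶜ : Set (Cd d)), h x.1 * φ (‖x.1‖) ∂(μ.comap (↑)) := by
      rw [integral_subtype_comap (measurableSet_singleton _).compl fun x ↦ h x * φ (‖x‖),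
        restrict_compl_singleton]
    _ = ∫ x, h x.1 * (x.2.1 ^ k * φ x.2) ∂μ.toSphere.prod (.volumeIoiPow (2 * d - 1)) := by
      rw [← finrank_Cd, ← μ.measurePreserving_homeomorphUnitSphereProd.integral_comp
        (Homeomorph.measurableEmbedding _)
        (fun x => h x.1 * (x.2.1 ^ k * φ x.2))]
      congr 1
      ext x
      have hx : 0 < ‖x.1‖ := norm_pos_iff.2 x.2
      simp only [homeomorphUnitSphereProd_apply_snd_coe, homeomorphUnitSphereProd_apply_fst_coe]
      rw [hh _ (inv_pos.2 hx), inv_pow]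
      field_simp
    _ = (∫ s, h s ∂μ.toSphere) * ∫ x : Set.Ioi (0 : ℝ), x.1 ^ k * φ x ∂.volumeIoiPow (2 * d - 1) :=
      integral_prod_mul (fun s : sphere (0 : Cd d) 1 => h s) (fun x : Set.Ioi (0 : ℝ) => x.1 ^ k * φ x)
    _ = _ := by
      congr 1
      simp only [Measure.volumeIoiPow, ENNReal.ofReal]
      rw [integral_withDensity_eq_integral_smul,
        integral_subtype_comap measurableSet_Ioi
          fun a ↦ Real.toNNReal (a ^ (2 * d - 1)) • (a ^ k * φ a),
        setIntegral_congr_fun measurableSet_Ioi fun x hx ↦ ?_]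
      · rw [NNReal.smul_def, Real.coe_toNNReal _ (pow_nonneg (le_of_lt hx) _), smul_eq_mul]
      · exact (measurable_subtype_coe.pow_const _).real_toNNReal

lemma herm_eq_inner {d : ℕ} (z w : Cd d) : herm z w = inner ℂ w z := by
  simp [herm, PiLp.inner_apply]

lemma complex_gauss (k : ℕ) :
    ∫ x : ℂ, ‖x‖ ^ (2 * k) * Real.exp (-‖x‖ ^ 2) = Real.pi * k.factorial := by
  have h := Complex.integral_rpow_mul_exp_neg_rpow (p := 2) (q := (2 * k : ℕ)) (by norm_num)
    (lt_of_lt_of_le (by norm_num) (Nat.cast_nonneg _))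
  have e : (((2 * k : ℕ) : ℝ) + 2) / 2 = k + 1 := by push_cast; ring
  rw [e, Real.Gamma_nat_eq_factorial] at h
  simp only [Real.rpow_natCast, Real.rpow_ofNat] at h
  rw [h]; ring

/-- Gaussian moments. -/
lemma gauss_moment {d : ℕ} (hd : 0 < d) (z : Cd d) (k : ℕ) :
    ∫ w : Cd d, ‖herm z w‖ ^ (2 * k) * Real.exp (-‖w‖ ^ 2) =
      k.factorial * ‖z‖ ^ (2 * k) * ∫ w : Cd d, Real.exp (-‖w‖ ^ 2) := by
  have hnt := nontrivial_Cd hd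
  obtain ⟨e, he, hze⟩ : ∃ e : Cd d, ‖e‖ = 1 ∧ z = ((‖z‖ : ℝ) : ℂ) • e := by
    by_cases hz : z = 0
    · obtain ⟨e, he⟩ := exists_norm_eq (Cd d) zero_le_one
      exact ⟨e, he, by simp [hz]⟩
    · refine ⟨((‖z‖⁻¹ : ℝ) : ℂ) • z, ?_, ?_⟩
      · rw [norm_smul]; simp [hz]
      · rw [smul_smul, ← Complex.ofReal_mul, mul_inv_cancel₀ (by simpa using hz)]; simp
  let i0 : Fin d := ⟨0, hd⟩
  obtain ⟨b, hb⟩ := Orthonormal.exists_orthonormalBasis_extension_of_card_eq (𝕜 := ℂ) (E := Cd d)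
    (ι := Fin d) (by simp) (v := fun _ => e) (s := {i0}) (by
      constructor
      · intro i; simpa using he
      · intro i j hij; exact absurd (Subsingleton.elim i j) hij)
  have hb0 : b i0 = e := hb i0 rfl
  let Φ : (Fin d → ℂ) ≃L[ℂ] Cd d := b.toBasis.equivFun.symm.toContinuousLinearEquiv
  have hΦ : ∀ x, Φ x = ∑ i, x i • b i := fun x => by
    change b.toBasis.equivFun.symm x = _
    rw [Module.Basis.equivFun_symm_apply]
    simp
  have hrepr : ∀ x i, inner ℂ (b i) (Φ x) = x i := by
    intro x i
    rw [hΦ, b.orthonormal.inner_right_fintype]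
  have hnorm : ∀ x, ‖Φ x‖ ^ 2 = ∑ i, ‖x i‖ ^ 2 := by
    intro x
    rw [← b.sum_sq_norm_inner_right (Φ x)]
    simp [hrepr]
  have hherm : ∀ x, ‖herm z (Φ x)‖ = ‖z‖ * ‖x i0‖ := by
    intro x
    rw [herm_eq_inner, hze, inner_smul_right, norm_mul, ← hze, norm_inner_symm, ← hb0, hrepr]
    simp
  have hH : (Measure.map Φ (volume : Measure (Fin d → ℂ))).IsAddHaarMeasure :=
    Φ.isAddHaarMeasure_map _
  have hμ := Measure.isAddLeftInvariant_eq_smul (volume : Measure (Cd d))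
    (Measure.map Φ (volume : Measure (Fin d → ℂ)))
  set c := Measure.addHaarScalarFactor (volume : Measure (Cd d))
    (Measure.map Φ (volume : Measure (Fin d → ℂ)))
  have hcov : ∀ f : Cd d → ℝ, ∫ w, f w = c • ∫ x : Fin d → ℂ, f (Φ x) := by
    intro f
    rw [hμ, integral_smul_nnreal_measure]
    congr 1
    exact integral_map_equiv Φ.toHomeomorph.toMeasurableEquiv f
  rw [hcov, hcov]
  simp only [hnorm, hherm]
  have h0 : ∫ x : Fin d → ℂ, Real.exp (-∑ i, ‖x i‖ ^ 2) = Real.pi ^ d := by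
    have := integral_fintype_prod_eq_prod (𝕜 := ℝ) (fun (_ : Fin d) (x : ℂ) => Real.exp (-‖x‖ ^ 2))
      (μ := fun _ => volume)
    have h2 := complex_gauss 0
    simp only [mul_zero, pow_zero, one_mul, Nat.factorial_zero, Nat.cast_one, mul_one] at h2
    simp only [h2, Finset.prod_const, Finset.card_univ, Fintype.card_fin] at this
    rw [← this]
    simp only [← Real.exp_sum, Finset.sum_neg_distrib]
    rfl
  have h1 : ∫ x : Fin d → ℂ, (‖z‖ * ‖x i0‖) ^ (2 * k) * Real.exp (-∑ i, ‖x i‖ ^ 2) =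
      ‖z‖ ^ (2 * k) * (k.factorial * Real.pi ^ d) := by
    have := integral_fintype_prod_eq_prod (𝕜 := ℝ)
      (fun (i : Fin d) (x : ℂ) => ‖x‖ ^ (2 * (if i = i0 then k else 0)) * Real.exp (-‖x‖ ^ 2))
      (μ := fun _ => volume)
    simp only [complex_gauss, Finset.prod_mul_distrib, Finset.prod_const, Finset.card_univ,
      Fintype.card_fin] at this
    have e1 : (∏ i : Fin d, (((if i = i0 then k else 0).factorial : ℕ) : ℝ)) = k.factorial := by
      rw [Finset.prod_eq_single i0]
      · simp
      · intro b _ hb; simp [hb]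
      · simp
    rw [e1] at this
    rw [mul_comm (k.factorial : ℝ), ← this, ← integral_const_mul]
    congr 1
    ext x
    have e2 : ∏ i : Fin d, ‖x i‖ ^ (2 * (if i = i0 then k else 0)) = ‖x i0‖ ^ (2 * k) := by
      rw [Finset.prod_eq_single i0]
      · simp
      · intro b _ hb; simp [hb]
      · simp
    rw [e2, ← Real.exp_sum, Finset.sum_neg_distrib, mul_pow]
    ring
  rw [h0, h1, NNReal.smul_def, NNReal.smul_def, smul_eq_mul, smul_eq_mul]
  ring


lemma herm_smul_real {d : ℕ} (z w : Cd d) (r : ℝ) : herm z (r • w) = r * herm z w := by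
  simp only [herm, Finset.mul_sum]
  refine Finset.sum_congr rfl fun j _ => ?_
  simp
  ring

lemma herm_smul {d : ℕ} (z w : Cd d) (r : ℂ) : herm z (r • w) = (starRingEnd ℂ) r * herm z w := by
  rw [herm_eq_inner, inner_smul_left, herm_eq_inner]

lemma norm_herm_le {d : ℕ} (z w : Cd d) : ‖herm z w‖ ≤ ‖z‖ * ‖w‖ := by
  rw [herm_eq_inner, mul_comm]; exact norm_inner_le_norm _ _

lemma continuous_herm {d : ℕ} (z : Cd d) : Continuous (herm z) := by
  unfold herm; fun_prop

lemma setInt_ball_eq {d : ℕ} (h : Cd d → ℝ) (φ : ℝ → ℝ) :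
    ∫ w in unitBall d, h w * φ ‖w‖ = ∫ w, h w * (Set.Iio 1).indicator φ ‖w‖ := by
  rw [unitBall, ← integral_indicator measurableSet_ball]
  congr 1
  ext w
  by_cases hw : ‖w‖ < 1 <;> simp [Set.indicator, hw]

lemma ball_moment_vol {d : ℕ} (hd : 0 < d) (z : Cd d) (k : ℕ) {σ : ℝ} (hσ : -1 < σ) :
    ∫ w in unitBall d, ‖herm z w‖ ^ (2 * k) * (1 - ‖w‖ ^ 2) ^ σ =
      (volume : Measure (Cd d)).real (unitBall d) * (k.factorial * ‖z‖ ^ (2 * k) *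
        Real.Gamma (d + 1) * Real.Gamma (σ + 1) / Real.Gamma (d + k + σ + 1)) := by
  have hd' : (0:ℝ) < d := by exact_mod_cast hd
  have hh : ∀ (r : ℝ), 0 < r → ∀ x, ‖herm z (r • x)‖ ^ (2 * k) = r ^ (2 * k) * ‖herm z x‖ ^ (2 * k) := by
    intro r hr x
    rw [herm_smul_real, norm_mul, mul_pow, Complex.norm_real, Real.norm_of_nonneg hr.le]
  have key : ∀ m k : ℕ, 0 < m → ∀ y : ℝ, ∀ t : ℝ, y ^ (2 * m - 1) * (y ^ (2 * k) * t) = y ^ (2 * (m + k) - 1) * t := by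
    intro m k hm y t
    rw [← mul_assoc, ← pow_add]; congr 2; omega
  have A := polar_homog hd (fun w => ‖herm z w‖ ^ (2 * k)) (2 * k) hh (fun y => Real.exp (-y ^ 2))
  have B := polar_homog hd (fun w => ‖herm z w‖ ^ (2 * k)) (2 * k) hh
    ((Set.Iio 1).indicator fun y => (1 - y ^ 2) ^ σ)
  have C := polar_homog hd (fun _ => 1) (2 * 0) (by simp) (fun y => Real.exp (-y ^ 2))
  have D := polar_homog hd (fun _ => 1) (2 * 0) (by simp)
    ((Set.Iio 1).indicator fun y => (1 - y ^ 2) ^ (0:ℝ))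
  simp only [key d _ hd] at A B C D
  rw [radial_gauss _ (by omega)] at A C
  rw [radial_beta _ (by omega) hσ] at B
  rw [radial_beta _ (by omega) (by norm_num)] at D
  rw [← setInt_ball_eq] at B D
  rw [gauss_moment hd] at A
  rw [B]
  simp only [one_mul, Real.rpow_zero, integral_const, smul_eq_mul, mul_one, measureReal_restrict_apply_univ,
    add_zero, zero_add, Real.Gamma_one] at D C
  rw [D]
  rw [C] at A
  push_cast at A ⊢
  have g1 := Real.Gamma_pos_of_pos (show (0:ℝ) < d + k by positivity)
  have g2 := Real.Gamma_pos_of_pos (show (0:ℝ) < d + 1 by positivity)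
  have g3 := Real.Gamma_pos_of_pos (show (0:ℝ) < d + k + σ + 1 by linarith [(Nat.cast_nonneg k : (0:ℝ) ≤ k)])
  field_simp
  field_simp at A
  linear_combination (-Real.Gamma (σ + 1)) * A

lemma vol_ball_pos (d : ℕ) : 0 < (volume : Measure (Cd d)).real (unitBall d) := by
  rw [Measure.real, ENNReal.toReal_pos_iff]
  exact ⟨measure_ball_pos _ _ one_pos, measure_ball_lt_top⟩

lemma setInt_normVol {d : ℕ} {F : Type*} [NormedAddCommGroup F] [NormedSpace ℝ F] (f : Cd d → F) :
    ∫ w in unitBall d, f w ∂(normVol d) =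
      ((volume : Measure (Cd d)).real (unitBall d))⁻¹ • ∫ w in unitBall d, f w := by
  rw [normVol, Measure.restrict_smul, integral_smul_measure, ENNReal.toReal_inv, Measure.real]

lemma cCoef_pos {d : ℕ} {σ : ℝ} (hσ : -1 < σ) : 0 < cCoef d σ := by
  unfold cCoef
  have hd' : (0:ℝ) ≤ d := Nat.cast_nonneg _
  have := Real.Gamma_pos_of_pos (show (0:ℝ) < d + σ + 1 by linarith)
  have := Real.Gamma_pos_of_pos (show (0:ℝ) < σ + 1 by linarith)
  have := Real.Gamma_pos_of_pos (show (0:ℝ) < d + 1 by linarith)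
  positivity

lemma ball_moment {d : ℕ} (hd : 0 < d) (z : Cd d) (k : ℕ) {σ : ℝ} (hσ : -1 < σ) :
    ∫ w in unitBall d, ‖herm z w‖ ^ (2 * k) * (1 - ‖w‖ ^ 2) ^ σ ∂(normVol d) =
      k.factorial * ‖z‖ ^ (2 * k) * (Real.Gamma (d + 1 + σ) / Real.Gamma (d + 1 + σ + k)) /
        cCoef d σ := by
  rw [setInt_normVol, ball_moment_vol hd z k hσ, smul_eq_mul, inv_mul_cancel_left₀ (vol_ball_pos d).ne']
  unfold cCoef
  have hd' : (0:ℝ) ≤ d := Nat.cast_nonneg _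
  have := Real.Gamma_pos_of_pos (show (0:ℝ) < d + 1 + σ by linarith)
  rw [show (d:ℝ) + σ + 1 = d + 1 + σ by ring, show (d:ℝ) + k + σ + 1 = d + 1 + σ + k by ring]
  field_simp

lemma integrable_weight {d : ℕ} (hd : 0 < d) {σ : ℝ} (hσ : -1 < σ) :
    IntegrableOn (fun w : Cd d => (1 - ‖w‖ ^ 2) ^ σ) (unitBall d) (normVol d) := by
  by_contra h
  have h1 := ball_moment hd (0 : Cd d) 0 hσ
  simp only [mul_zero, pow_zero, one_mul, Nat.factorial_zero, Nat.cast_one, Nat.cast_zero, add_zero] at h1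
  rw [integral_undef h] at h1
  have hd' : (0:ℝ) ≤ d := Nat.cast_nonneg _
  have h2 := Real.Gamma_pos_of_pos (show (0:ℝ) < d + 1 + σ by linarith)
  rw [div_self h2.ne'] at h1
  have := cCoef_pos (d := d) hσ
  have : 0 < 1 / cCoef d σ := by positivity
  linarith

lemma rot_integral {d : ℕ} (f : Cd d → ℂ) (u : ℂ) (hu : ‖u‖ = 1) :
    ∫ w in unitBall d, f (u • w) ∂(normVol d) = ∫ w in unitBall d, f w ∂(normVol d) := by
  have hu0 : u ≠ 0 := by rintro rfl; simp at hu
  let L : Cd d ≃ₗᵢ[ℝ] Cd d :=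
    { (LinearEquiv.smulOfNeZero ℂ (Cd d) u hu0).restrictScalars ℝ with
      norm_map' := fun x => by
        change ‖u • x‖ = ‖x‖
        rw [norm_smul, hu, one_mul] }
  have hL : MeasurePreserving L (volume : Measure (Cd d)) volume := L.measurePreserving
  rw [setInt_normVol, setInt_normVol]
  congr 1
  have h := hL.setIntegral_preimage_emb L.toHomeomorph.measurableEmbedding f (unitBall d)
  rw [← h]
  have : L ⁻¹' unitBall d = unitBall d := by
    ext x; simp [unitBall]
  rw [this]
  rfl

lemma ball_orth {d : ℕ} (z : Cd d) {j k : ℕ} (hjk : j ≠ k) (σ : ℝ) :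
    ∫ w in unitBall d, herm z w ^ j * (starRingEnd ℂ) (herm z w) ^ k *
      (((1 - ‖w‖ ^ 2) ^ σ : ℝ) : ℂ) ∂(normVol d) = 0 := by
  set I := ∫ w in unitBall d, herm z w ^ j * (starRingEnd ℂ) (herm z w) ^ k *
      (((1 - ‖w‖ ^ 2) ^ σ : ℝ) : ℂ) ∂(normVol d) with hI
  let u : ℂ := Complex.exp (Complex.I)
  have hu : ‖u‖ = 1 := by simpa using Complex.norm_exp_ofReal_mul_I 1
  have h := rot_integral (fun w => herm z w ^ j * (starRingEnd ℂ) (herm z w) ^ k *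
      (((1 - ‖w‖ ^ 2) ^ σ : ℝ) : ℂ)) u hu
  rw [← hI] at h
  have h2 : (starRingEnd ℂ u) ^ j * u ^ k * I = I := by
    conv_rhs => rw [← h]
    rw [hI, ← integral_const_mul]
    congr 1
    ext w
    rw [herm_smul, norm_smul, hu, one_mul, map_mul, Complex.conj_conj]
    ring
  by_contra hne
  have h3 : (starRingEnd ℂ u) ^ j * u ^ k = 1 := mul_right_cancel₀ hne (by rw [h2, one_mul])
  have h4 : starRingEnd ℂ u = Complex.exp (-Complex.I) := by
    rw [← Complex.exp_conj]; simp
  rw [h4, ← Complex.exp_nat_mul, ← Complex.exp_nat_mul, ← Complex.exp_add, Complex.exp_eq_one_iff] at h3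
  obtain ⟨m, hm⟩ := h3
  have h5 : (k : ℝ) - j = m * (2 * Real.pi) := by
    have := congrArg Complex.im hm
    simp at this
    linarith
  have hm0 : (m : ℝ) ≠ 0 := by
    intro h0
    rw [h0, zero_mul, sub_eq_zero] at h5
    exact hjk (by exact_mod_cast h5.symm)
  have : Real.pi = ((((k : ℤ) - j : ℤ) / (2 * m : ℤ) : ℚ) : ℝ) := by
    push_cast
    rw [h5]; field_simp
  exact irrational_pi ⟨_, this.symm⟩


lemma ae_ball {d : ℕ} {p : Cd d → Prop} (h : ∀ w, ‖w‖ < 1 → p w) :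
    ∀ᵐ w ∂(normVol d).restrict (unitBall d), p w := by
  have : MeasurableSet (unitBall d) := measurableSet_ball
  filter_upwards [ae_restrict_mem this] with w hw
  exact h w (by simpa [unitBall] using hw)

lemma integrable_mul_weight {d : ℕ} (hd : 0 < d) {σ : ℝ} (hσ : -1 < σ) (f : Cd d → ℂ)
    (hf : Continuous f) (C : ℝ) (hC : ∀ w, ‖w‖ < 1 → ‖f w‖ ≤ C) :
    Integrable (fun w => f w * (((1 - ‖w‖ ^ 2) ^ σ : ℝ) : ℂ)) ((normVol d).restrict (unitBall d)) := by
  have h : Integrable (fun w : Cd d => (((1 - ‖w‖ ^ 2) ^ σ : ℝ) : ℂ))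
    ((normVol d).restrict (unitBall d)) := (integrable_weight hd hσ).ofReal
  exact h.bdd_mul hf.aestronglyMeasurable (ae_ball hC)

lemma partial_sum_integral {d : ℕ} (hd : 0 < d) {σ : ℝ} (hσ : -1 < σ) (z : Cd d) (b : ℕ → ℝ) (K : ℕ) :
    ∫ w in unitBall d, ‖∑ k ∈ Finset.range K, (b k : ℂ) * herm z w ^ k‖ ^ 2 * (1 - ‖w‖ ^ 2) ^ σ
      ∂(normVol d) = ∑ k ∈ Finset.range K, b k ^ 2 * (k.factorial * ‖z‖ ^ (2 * k) *
        (Real.Gamma (d + 1 + σ) / Real.Gamma (d + 1 + σ + k)) / cCoef d σ) := by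
  have hInt : ∀ j k : ℕ, Integrable (fun w => herm z w ^ j * (starRingEnd ℂ) (herm z w) ^ k *
      (((1 - ‖w‖ ^ 2) ^ σ : ℝ) : ℂ)) ((normVol d).restrict (unitBall d)) := by
    intro j k
    refine integrable_mul_weight hd hσ (fun w => herm z w ^ j * (starRingEnd ℂ) (herm z w) ^ k) ?_
      (‖z‖ ^ j * ‖z‖ ^ k) ?_
    · have := continuous_herm z
      fun_prop
    · intro w hw
      have : ‖herm z w‖ ≤ ‖z‖ := (norm_herm_le z w).trans
        (mul_le_of_le_one_right (norm_nonneg _) hw.le)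
      rw [norm_mul, norm_pow, norm_pow, RCLike.norm_conj]
      gcongr
  have hdiag : ∀ k : ℕ, ∫ w in unitBall d, herm z w ^ k * (starRingEnd ℂ) (herm z w) ^ k *
      (((1 - ‖w‖ ^ 2) ^ σ : ℝ) : ℂ) ∂(normVol d) = ((k.factorial * ‖z‖ ^ (2 * k) *
        (Real.Gamma (d + 1 + σ) / Real.Gamma (d + 1 + σ + k)) / cCoef d σ : ℝ) : ℂ) := by
    intro k
    rw [← ball_moment hd z k hσ, ← integral_complex_ofReal]
    congr 1
    ext w
    rw [← mul_pow, Complex.mul_conj, pow_mul, Complex.normSq_eq_norm_sq]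
    push_cast
    rfl
  rw [← Complex.ofReal_inj, ← integral_complex_ofReal]
  have e : ∀ w : Cd d, ((‖∑ k ∈ Finset.range K, (b k : ℂ) * herm z w ^ k‖ ^ 2 * (1 - ‖w‖ ^ 2) ^ σ : ℝ) : ℂ)
      = ∑ j ∈ Finset.range K, ∑ k ∈ Finset.range K, ((b j : ℂ) * b k) * (herm z w ^ j *
        (starRingEnd ℂ) (herm z w) ^ k * (((1 - ‖w‖ ^ 2) ^ σ : ℝ) : ℂ)) := by
    intro w
    rw [← Complex.normSq_eq_norm_sq, Complex.ofReal_mul, ← Complex.mul_conj, map_sum, Finset.sum_mul_sum,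
      Finset.sum_mul]
    refine Finset.sum_congr rfl fun j _ => ?_
    rw [Finset.sum_mul]
    refine Finset.sum_congr rfl fun k _ => ?_
    rw [map_mul, map_pow, Complex.conj_ofReal]
    ring
  simp only [e]
  rw [integral_finsetSum _ fun j _ => integrable_finsetSum _ fun k _ => (hInt j k).const_mul _]
  rw [Complex.ofReal_sum]
  refine Finset.sum_congr rfl fun j hj => ?_
  rw [integral_finsetSum _ fun k _ => (hInt j k).const_mul _, Finset.sum_eq_single j]
  · rw [integral_const_mul, hdiag, ← Complex.ofReal_mul, ← Complex.ofReal_mul, sq]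
  · intro k _ hk
    rw [integral_const_mul, ball_orth z hk.symm, mul_zero]
  · intro h; exact absurd hj h

lemma coef_bound {l : ℝ} (hl : 0 < l) {n : ℕ} (hn : 0 < n) (k : ℕ) :
    bc ((l + n) / 2) k ^ 2 * (k.factorial * (Real.Gamma l / Real.Gamma (l + k))) ≤
      Real.Gamma l * Real.Gamma n / Real.Gamma ((l + n) / 2) ^ 2 * bc n k := by
  have hn' : (0:ℝ) < n := by exact_mod_cast hn
  have h := gamma_sq_le (s := l + k) (t := n + k) (by positivity) (by positivity)
  rw [show (l + k + (n + k)) / 2 = (l + n) / 2 + k by ring] at h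
  have g1 := Real.Gamma_pos_of_pos hl
  have g2 := Real.Gamma_pos_of_pos hn'
  have g3 := Real.Gamma_pos_of_pos (show 0 < (l + n) / 2 by positivity)
  have g4 := Real.Gamma_pos_of_pos (show 0 < l + k by positivity)
  have hk : (0:ℝ) < k.factorial := by positivity
  unfold bc
  calc _ = Real.Gamma ((l + n) / 2 + k) ^ 2 * (Real.Gamma l / (Real.Gamma ((l + n) / 2) ^ 2 *
            k.factorial * Real.Gamma (l + k))) := by field_simp
    _ ≤ (Real.Gamma (l + k) * Real.Gamma (n + k)) * (Real.Gamma l / (Real.Gamma ((l + n) / 2) ^ 2 *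
            k.factorial * Real.Gamma (l + k))) := by gcongr
    _ = _ := by field_simp

lemma key_ineq {d n : ℕ} (hd : 0 < d) (hn : 0 < n) {σ : ℝ} (hσ : -1 < σ) (z : Cd d) (hz : ‖z‖ < 1)
    {l : ℝ} (hl : l = d + 1 + σ) :
    (1 - ‖z‖ ^ 2) ^ n * (cCoef d σ * ∫ w in unitBall d, ‖1 - herm z w‖ ^ (-(l + n)) *
      (1 - ‖w‖ ^ 2) ^ σ ∂(normVol d)) ≤
      Real.Gamma l * Real.Gamma n / Real.Gamma ((l + n) / 2) ^ 2 := by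
  have hd' : (0:ℝ) ≤ d := Nat.cast_nonneg _
  have hn' : (0:ℝ) < n := by exact_mod_cast hn
  have hl0 : 0 < l := by linarith
  set a := (l + n) / 2 with ha
  have ha0 : 0 < a := by positivity
  have hz2 : ‖z‖ ^ 2 < 1 := by rw [sq_lt_one_iff₀ (norm_nonneg _)]; exact hz
  have hc := cCoef_pos (d := d) hσ
  have hhw : ∀ w : Cd d, ‖w‖ < 1 → ‖herm z w‖ ≤ ‖z‖ := fun w hw => (norm_herm_le z w).trans
        (mul_le_of_le_one_right (norm_nonneg _) hw.le)
  set M := Real.Gamma l * Real.Gamma n / Real.Gamma a ^ 2 with hM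
  have hM0 : 0 < M := by
    have := Real.Gamma_pos_of_pos hl0
    have := Real.Gamma_pos_of_pos hn'
    have := Real.Gamma_pos_of_pos ha0
    positivity
  have hsum := hasSum_bc_real hn' (sq_nonneg ‖z‖) hz2
  have hsumz := hasSum_bc_real ha0 (norm_nonneg z) hz
  -- bound for partial sums
  have hpart : ∀ K : ℕ, ∫ w in unitBall d, ‖∑ k ∈ Finset.range K, (bc a k : ℂ) * herm z w ^ k‖ ^ 2 *
      (1 - ‖w‖ ^ 2) ^ σ ∂(normVol d) ≤ M * (1 - ‖z‖ ^ 2) ^ (-(n : ℝ)) / cCoef d σ := by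
    intro K
    rw [partial_sum_integral hd hσ]
    calc _ ≤ ∑ k ∈ Finset.range K, M * (bc n k * (‖z‖ ^ 2) ^ k) / cCoef d σ := by
          refine Finset.sum_le_sum fun k _ => ?_
          have h := coef_bound hl0 hn k
          rw [← ha, ← hM] at h
          rw [← hl]
          calc _ = (bc a k ^ 2 * (k.factorial * (Real.Gamma l / Real.Gamma (l + k)))) * (‖z‖ ^ (2 * k)) /
                cCoef d σ := by ring
            _ ≤ (M * bc n k) * (‖z‖ ^ (2 * k)) / cCoef d σ := by gcongr
            _ = _ := by rw [pow_mul]; ring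
      _ = M * (∑ k ∈ Finset.range K, bc n k * (‖z‖ ^ 2) ^ k) / cCoef d σ := by
          rw [Finset.mul_sum, Finset.sum_div]
      _ ≤ _ := by
          gcongr
          exact sum_le_hasSum _ (fun k _ => mul_nonneg (bc_pos hn' k).le (by positivity)) hsum
  have hlim : Filter.Tendsto (fun K : ℕ => ∫ w in unitBall d,
      ‖∑ k ∈ Finset.range K, (bc a k : ℂ) * herm z w ^ k‖ ^ 2 * (1 - ‖w‖ ^ 2) ^ σ ∂(normVol d))
      Filter.atTop (nhds (∫ w in unitBall d, ‖1 - herm z w‖ ^ (-(l + n)) *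
      (1 - ‖w‖ ^ 2) ^ σ ∂(normVol d))) := by
    refine tendsto_integral_of_dominated_convergence
      (fun w => ((1 - ‖z‖) ^ (-a)) ^ 2 * (1 - ‖w‖ ^ 2) ^ σ) ?_ ?_ ?_ ?_
    · intro K
      have := continuous_herm z
      refine Continuous.aestronglyMeasurable ?_ |>.mul (integrable_weight hd hσ).aestronglyMeasurable
      fun_prop
    · exact (integrable_weight hd hσ).const_mul _
    · intro K
      refine ae_ball fun w hw => ?_
      have hw2 : 0 ≤ 1 - ‖w‖ ^ 2 := by
        have : ‖w‖ ^ 2 < 1 := by rw [sq_lt_one_iff₀ (norm_nonneg _)]; exact hw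
        linarith
      rw [Real.norm_of_nonneg (mul_nonneg (by positivity) (Real.rpow_nonneg hw2 _))]
      refine mul_le_mul_of_nonneg_right ?_ (Real.rpow_nonneg hw2 _)
      gcongr
      calc _ ≤ ∑ k ∈ Finset.range K, bc a k * ‖z‖ ^ k := by
            refine norm_sum_le_of_le _ fun k _ => ?_
            rw [norm_mul, norm_pow, Complex.norm_real, Real.norm_of_nonneg (bc_pos ha0 k).le]
            have := (bc_pos ha0 k).le
            gcongr
            exact hhw w hw
        _ ≤ _ := sum_le_hasSum _ (fun k _ => mul_nonneg (bc_pos ha0 k).le (by positivity)) hsumz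
    · refine ae_ball fun w hw => ?_
      have hlt : ‖herm z w‖ < 1 := (hhw w hw).trans_lt hz
      have h := (hasSum_bc_complex ha0 hlt).tendsto_sum_nat
      have h2 := (h.norm.pow 2).mul_const ((1 - ‖w‖ ^ 2) ^ σ)
      have e : ‖(1 - herm z w) ^ (-(a : ℂ))‖ ^ 2 = ‖1 - herm z w‖ ^ (-(l + n)) := by
        rw [← Complex.ofReal_neg, Complex.norm_cpow_real, ← Real.rpow_natCast,
          ← Real.rpow_mul (norm_nonneg _)]
        congr 1
        rw [ha]; push_cast; ring
      rw [e] at h2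
      exact h2
  have hfin := le_of_tendsto' hlim hpart
  have hp : 0 < 1 - ‖z‖ ^ 2 := by linarith
  calc _ ≤ (1 - ‖z‖ ^ 2) ^ n * (cCoef d σ * (M * (1 - ‖z‖ ^ 2) ^ (-(n : ℝ)) / cCoef d σ)) := by gcongr
    _ = M := by
      rw [Real.rpow_neg hp.le, Real.rpow_natCast]
      field_simp


def KernRep (d : ℕ) (f : Cd d → ℂ) (p : ℝ) (g : Cd d → ℂ) : Prop :=
  Integrable g ((normVol d).restrict (unitBall d)) ∧ ∀ z, ‖z‖ < 1 →
    f z = ∫ w, (Real.Gamma p : ℂ) * (1 - herm z w) ^ (-(p : ℂ)) * g w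
      ∂((normVol d).restrict (unitBall d))

lemma herm_lower {d : ℕ} {x w : Cd d} (hw : ‖w‖ < 1) : 1 - ‖x‖ ≤ (1 - herm x w).re := by
  have h1 := norm_herm_le x w
  have h2 := Complex.re_le_norm (herm x w)
  have h3 : ‖x‖ * ‖w‖ ≤ ‖x‖ := mul_le_of_le_one_right (norm_nonneg _) hw.le
  simp only [Complex.sub_re, Complex.one_re]
  linarith

lemma kern_bound {d : ℕ} {x w : Cd d} (hw : ‖w‖ < 1) {δ q : ℝ} (hδ : 0 < δ) (hq : 0 < q)
    (hx : δ ≤ 1 - ‖x‖) : ‖(1 - herm x w) ^ (-(q : ℂ))‖ ≤ δ ^ (-q) := by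
  have h := herm_lower (x := x) hw
  have h1 : δ ≤ ‖1 - herm x w‖ := (hx.trans h).trans (Complex.re_le_norm _)
  rw [← Complex.ofReal_neg, Complex.norm_cpow_real]
  exact Real.rpow_le_rpow_of_nonpos hδ h1 (by linarith)

lemma kern_meas {d : ℕ} (z : Cd d) (q : ℂ) :
    Measurable (fun w : Cd d => (1 - herm z w) ^ q) := by
  have := (continuous_herm z).measurable
  exact (measurable_const.sub this).pow_const _

lemma rep_step {d : ℕ} {f : Cd d → ℂ} {p : ℝ} {g : Cd d → ℂ} (hp : 0 < p)
    (h : KernRep d f p g) (j : Fin d) :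
    KernRep d (pd d j f) (p + 1) (fun w => (starRingEnd ℂ) (w j) * g w) := by
  obtain ⟨hg, hf⟩ := h
  set ν := (normVol d).restrict (unitBall d) with hν
  have hcoord : Continuous (fun w : Cd d => (starRingEnd ℂ) (w j)) := by fun_prop
  refine ⟨?_, ?_⟩
  · refine hg.bdd_mul (c := 1) hcoord.aestronglyMeasurable ?_
    refine ae_ball fun w hw => ?_
    rw [RCLike.norm_conj]
    exact (PiLp.norm_apply_le w j).trans hw.le
  · intro z hz
    set δ := (1 - ‖z‖) / 2 with hδdef
    have hδ : 0 < δ := by simp only [δ]; linarith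
    have hxδ : ∀ x ∈ ball z δ, δ ≤ 1 - ‖x‖ := by
      intro x hx
      have h1 : ‖x - z‖ < δ := by rwa [← dist_eq_norm]
      have h2 : ‖x‖ ≤ ‖z‖ + ‖x - z‖ := by
        have := norm_add_le z (x - z); simpa using this
      simp only [δ] at h1 ⊢; linarith
    have hInt : ∀ x ∈ ball z δ, Integrable
        (fun w => (Real.Gamma p : ℂ) * (1 - herm x w) ^ (-(p : ℂ)) * g w) ν := by
      intro x hx
      refine hg.bdd_mul (c := ‖(Real.Gamma p : ℂ)‖ * δ ^ (-p))
        ((kern_meas x _).const_mul _).aestronglyMeasurable ?_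
      refine ae_ball fun w hw => ?_
      rw [norm_mul]
      gcongr
      exact kern_bound hw hδ hp (hxδ x hx)
    let F' : Cd d → Cd d → (Cd d →L[ℂ] ℂ) := fun x w =>
      ((Real.Gamma (p + 1) : ℂ) * (1 - herm x w) ^ (-((p + 1 : ℝ) : ℂ)) * g w) • innerSL ℂ w
    have hF'm : AEStronglyMeasurable (F' z) ν := by
      have hc : Continuous (fun w : Cd d => innerSL ℂ w) := (innerSL ℂ (E := Cd d)).continuous
      have hm := (((kern_meas z (-((p + 1 : ℝ) : ℂ))).const_mul
        (Real.Gamma (p + 1) : ℂ)).aestronglyMeasurable (μ := ν)).mul hg.1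
      exact hm.smul hc.aestronglyMeasurable
    have key := hasFDerivAt_integral_of_dominated_of_fderiv_le (𝕜 := ℂ) (μ := ν)
      (F := fun x w => (Real.Gamma p : ℂ) * (1 - herm x w) ^ (-(p : ℂ)) * g w)
      (F' := F') (x₀ := z) (s := ball z δ)
      (bound := fun w => ‖(Real.Gamma (p + 1) : ℂ)‖ * δ ^ (-(p + 1)) * ‖g w‖)
      (ball_mem_nhds z hδ) ?_ (hInt z (mem_ball_self hδ)) ?_ ?_ ?_ ?_
    · have hF'int : Integrable (F' z) ν := by
        refine Integrable.mono' ((hg.norm).const_mul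
          (‖(Real.Gamma (p + 1) : ℂ)‖ * δ ^ (-(p + 1)))) ?_ ?_
        · exact hF'm
        · refine ae_ball fun w hw => ?_
          simp only [F']
          rw [norm_smul, norm_mul, norm_mul, innerSL_apply_norm]
          have := kern_bound (x := z) (q := p + 1) hw hδ (by linarith) (hxδ z (mem_ball_self hδ))
          calc _ ≤ ‖(Real.Gamma (p + 1) : ℂ)‖ * δ ^ (-(p + 1)) * ‖g w‖ * 1 := by gcongr
            _ = _ := mul_one _
      have hev : f =ᶠ[nhds z] fun x => ∫ w,
          (Real.Gamma p : ℂ) * (1 - herm x w) ^ (-(p : ℂ)) * g w ∂ν := by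
        filter_upwards [ball_mem_nhds z hδ] with x hx
        exact hf x (by have := hxδ x hx; linarith)
      have hfd : fderiv ℂ f z = ∫ w, F' z w ∂ν := (key.congr_of_eventuallyEq hev).fderiv
      simp only [pd]
      rw [hfd, ContinuousLinearMap.integral_apply hF'int]
      congr 1
      ext w
      simp only [F', smul_apply, innerSL_apply_apply, ← herm_eq_inner,
        smul_eq_mul]
      have : herm (EuclideanSpace.single j (1 : ℂ)) w = (starRingEnd ℂ) (w j) := by
        simp [herm, PiLp.single_apply]
      rw [this]; ring
    · filter_upwards [ball_mem_nhds z hδ] with x hx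
      exact (hInt x hx).1
    · exact hF'm
    · refine ae_ball fun w hw x hx => ?_
      simp only [F']
      rw [norm_smul, norm_mul, norm_mul, innerSL_apply_norm]
      have := kern_bound (x := x) (q := p + 1) hw hδ (by linarith) (hxδ x hx)
      calc _ ≤ ‖(Real.Gamma (p + 1) : ℂ)‖ * δ ^ (-(p + 1)) * ‖g w‖ * 1 := by gcongr
        _ = _ := mul_one _
    · exact hg.norm.const_mul _
    · refine ae_ball fun w hw x hx => ?_
      have hs : (1 - herm x w) ∈ slitPlane := Or.inl
        (lt_of_lt_of_le (lt_of_lt_of_le hδ (hxδ x hx)) (herm_lower hw))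
      have h1 : HasFDerivAt (fun x => 1 - herm x w) (-(innerSL ℂ w)) x := by
        have := ((innerSL ℂ w).hasFDerivAt (x := x)).const_sub (1 : ℂ)
        refine this.congr_of_eventuallyEq (Filter.Eventually.of_forall fun y => ?_)
        simp [herm_eq_inner]
      have h2 := ((((((hasDerivAt_id (1 - herm x w)).cpow_const (c := -(p : ℂ)) hs).comp_hasFDerivAt
        x h1)).const_mul
        (Real.Gamma p : ℂ)).mul_const (g w))
      have hE : F' x w = g w • (Real.Gamma p : ℂ) •
          (-(p : ℂ) * id (1 - herm x w) ^ (-(p : ℂ) - 1) * 1) • -(innerSL ℂ) w := ?_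
      · rw [hE]
        exact h2
      simp only [F']
      rw [Real.Gamma_add_one hp.ne']
      ext v
      simp only [smul_apply, smul_eq_mul, _root_.neg_apply, id]
      push_cast
      rw [show -((p : ℂ) + 1) = -(p : ℂ) - 1 by ring]
      ring

lemma rep_iter {d : ℕ} {f : Cd d → ℂ} {p : ℝ} {g : Cd d → ℂ} (hp : 0 < p)
    (h : KernRep d f p g) (j : Fin d) (m : ℕ) :
    KernRep d ((pd d j)^[m] f) (p + m) (fun w => (starRingEnd ℂ) (w j) ^ m * g w) := by
  induction m with
  | zero => simpa using h
  | succ m ih =>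
    rw [Function.iterate_succ_apply']
    have := rep_step (by positivity) ih j
    convert this using 1
    · push_cast; ring
    · ext w; ring

lemma rep_foldr {d : ℕ} {f : Cd d → ℂ} {p : ℝ} {g : Cd d → ℂ} (hp : 0 < p)
    (h : KernRep d f p g) (α : Fin d → ℕ) (L : List (Fin d)) :
    KernRep d (L.foldr (fun j g => (pd d j)^[α j] g) f) (p + ((L.map α).sum : ℕ))
      (fun w => (L.map (fun j => (starRingEnd ℂ) (w j) ^ α j)).prod * g w) := by
  induction L with
  | nil => simpa using h
  | cons j L ih =>
    have := rep_iter (by positivity) ih j (α j)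
    simp only [List.foldr_cons]
    convert this using 1
    · simp only [List.map_cons, List.sum_cons]; push_cast; ring
    · ext w; simp only [List.map_cons, List.prod_cons]; ring

lemma rep_mpd {d n : ℕ} {f : Cd d → ℂ} {p : ℝ} {g : Cd d → ℂ} (hp : 0 < p)
    (h : KernRep d f p g) (α : MIdx d n) :
    KernRep d (mpd d α.1 f) (p + n)
      (fun w => (starRingEnd ℂ) (Zmap d n w α) * g w) := by
  have := rep_foldr hp h α.1 (List.finRange d)
  have hα : ∑ j, α.1 j = n := α.2
  rw [← List.ofFn_eq_map, List.sum_ofFn, hα] at this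
  have h2 : (fun w : Cd d => (starRingEnd ℂ) (Zmap d n w α) * g w) = fun w =>
      (List.map (fun j => (starRingEnd ℂ) (w j) ^ α.1 j) (List.finRange d)).prod * g w := by
    funext w
    rw [← List.ofFn_eq_map, List.prod_ofFn]
    simp only [Zmap, map_prod, map_pow]
  rw [h2]
  exact this

lemma rep_bergman {d : ℕ} {σ lam : ℝ} (hd : 0 < d) (hσ : -1 < σ) (hlam : lam = d + 1 + σ)
    (G : Cd d → ℂ) (hG : Measurable G) (hGbd : ∀ w, ‖G w‖ ≤ 1) :
    KernRep d (bergman d σ G) lam (fun w => G w * ((cCoef d σ / Real.Gamma lam * (1 - ‖w‖ ^ 2) ^ σ : ℝ) : ℂ)) := by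
  have hl : 0 < lam := by
    have : (0 : ℝ) < d := by exact_mod_cast hd
    linarith
  have hΓ := Real.Gamma_pos_of_pos hl
  refine ⟨?_, ?_⟩
  · refine Integrable.bdd_mul (c := 1) ?_ hG.aestronglyMeasurable (Filter.Eventually.of_forall hGbd)
    exact ((integrable_weight hd hσ).const_mul _).ofReal
  · intro z hz
    rw [bergman, ← integral_const_mul]
    congr 1
    ext w
    rw [bergKer, ← hlam, Complex.cpow_neg]
    have : (Real.Gamma lam : ℂ) ≠ 0 := by exact_mod_cast hΓ.ne'
    push_cast
    field_simp


lemma dual_vec {E : Type} [AddCommGroup E] [Module ℂ E] (N : E → ℝ)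
    (hN_nonneg : ∀ x, 0 ≤ N x)
    (hN_def : ∀ x, N x = 0 → x = 0)
    (hN_add : ∀ x y, N (x + y) ≤ N x + N y)
    (hN_smul : ∀ (c : ℂ) (x), N (c • x) = ‖c‖ * N x) (x : E) :
    ∃ l : E →ₗ[ℂ] ℂ, l x = N x ∧ ∀ y, ‖l y‖ ≤ N y := by
  let _ : Norm E := ⟨N⟩
  have hc : NormedSpace.Core ℂ E :=
    { norm_nonneg := hN_nonneg
      norm_smul := hN_smul
      norm_triangle := hN_add
      norm_eq_zero_iff := fun y => ⟨hN_def y, by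
        rintro rfl
        have h00 : N 0 = 0 := by simpa using hN_smul 0 (0 : E)
        exact h00⟩ }
  let _ : NormedAddCommGroup E := NormedAddCommGroup.ofCore hc
  let _ : NormedSpace ℂ E := NormedSpace.ofCore hc
  obtain ⟨g, hg, hgx⟩ := exists_dual_vector'' ℂ x
  refine ⟨g.toLinearMap, hgx, fun y => ?_⟩
  have := g.le_opNorm y
  have h2 : ‖g‖ * ‖y‖ ≤ 1 * ‖y‖ := by gcongr
  rw [one_mul] at h2
  exact this.trans h2

lemma zmap_smul {d n : ℕ} (r : ℂ) (w : Cd d) : Zmap d n (r • w) = r ^ n • Zmap d n w := by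
  funext α
  have hα : ∑ j, α.1 j = n := α.2
  simp only [Zmap, Pi.smul_apply, smul_eq_mul, PiLp.smul_apply, mul_pow]
  rw [Finset.prod_mul_distrib, Finset.prod_pow_eq_pow_sum, hα]

lemma N_bound {ι : Type} [Fintype ι] (N : (ι → ℂ) → ℝ)
    (hN_nonneg : ∀ x, 0 ≤ N x)
    (hN_add : ∀ x y, N (x + y) ≤ N x + N y)
    (hN_smul : ∀ (c : ℂ) (x), N (c • x) = ‖c‖ * N x) (x : ι → ℂ) (hx : ∀ i, ‖x i‖ ≤ 1) :
    N x ≤ ∑ i, N (Pi.single i 1) := by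
  have h0 : N 0 = 0 := by simpa using hN_smul 0 (0 : ι → ℂ)
  have h1 : x = ∑ i, x i • (Pi.single i (1 : ℂ) : ι → ℂ) := by
    funext k; simp [Pi.single_apply]
  have h2 := Finset.le_sum_of_subadditive N h0.le hN_add Finset.univ
    (fun i => x i • (Pi.single i (1 : ℂ) : ι → ℂ))
  rw [← h1] at h2
  refine h2.trans (Finset.sum_le_sum fun i _ => ?_)
  rw [hN_smul]
  exact mul_le_of_le_one_left (hN_nonneg _) (hx i)

lemma maxC_bound {d n : ℕ} (hn : 0 < n) (N : (MIdx d n → ℂ) → ℝ)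
    (hN_nonneg : ∀ x, 0 ≤ N x)
    (hN_add : ∀ x y, N (x + y) ≤ N x + N y)
    (hN_smul : ∀ (c : ℂ) (x), N (c • x) = ‖c‖ * N x) (w : Cd d) (hw : ‖w‖ < 1) :
    N (Zmap d n w) ≤ maxC d n N := by
  have h0 : N 0 = 0 := by simpa using hN_smul 0 (0 : MIdx d n → ℂ)
  by_cases hw0 : w = 0
  · have : Zmap d n w = 0 := by
      have := zmap_smul (n := n) (0 : ℂ) w
      rw [zero_smul, zero_pow hn.ne', zero_smul] at this
      rw [hw0, this]
    rw [this, h0]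
    exact Real.iSup_nonneg fun _ => hN_nonneg _
  · have hpos : 0 < ‖w‖ := norm_pos_iff.mpr hw0
    have hC : (‖w‖ : ℂ) ≠ 0 := by exact_mod_cast hpos.ne'
    set ζ : Cd d := ((‖w‖ : ℂ)⁻¹) • w with hζ
    have hζ1 : ‖ζ‖ = 1 := by
      rw [hζ, norm_smul, norm_inv, Complex.norm_real, norm_norm, inv_mul_cancel₀ hpos.ne']
    have hwζ : w = (‖w‖ : ℂ) • ζ := by rw [hζ, smul_smul, mul_inv_cancel₀ hC, one_smul]
    have hbdd : BddAbove (Set.range fun ζ : Metric.sphere (0 : Cd d) 1 =>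
        N (Zmap d n (ζ : Cd d))) := by
      refine ⟨∑ i, N (Pi.single i 1), ?_⟩
      rintro _ ⟨⟨y, hy⟩, rfl⟩
      refine N_bound N hN_nonneg hN_add hN_smul _ fun α => ?_
      simp only [Zmap]
      rw [norm_prod]
      refine Finset.prod_le_one (fun _ _ => norm_nonneg _) fun j _ => ?_
      rw [norm_pow]
      refine pow_le_one₀ (norm_nonneg _) ?_
      have : ‖y‖ = 1 := by simpa using hy
      exact (PiLp.norm_apply_le y j).trans this.le
    have h1 : N (Zmap d n ζ) ≤ maxC d n N :=
      le_ciSup hbdd (⟨ζ, by simpa using hζ1⟩ : Metric.sphere (0 : Cd d) 1)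
    calc N (Zmap d n w) = ‖w‖ ^ n * N (Zmap d n ζ) := by
          conv_lhs => rw [hwζ]
          rw [zmap_smul, hN_smul, norm_pow, Complex.norm_real, norm_norm]
      _ ≤ N (Zmap d n ζ) := mul_le_of_le_one_left (hN_nonneg _)
          (pow_le_one₀ (norm_nonneg _) hw.le)
      _ ≤ _ := h1

lemma point_bound
    (d n : ℕ) (hd : 0 < d) (hn : 0 < n) (σ : ℝ) (hσ : -1 < σ)
    (lam : ℝ) (hlam : lam = d + 1 + σ)
    (N : (MIdx d n → ℂ) → ℝ)
    (hN_nonneg : ∀ x, 0 ≤ N x)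
    (hN_def : ∀ x, N x = 0 → x = 0)
    (hN_add : ∀ x y, N (x + y) ≤ N x + N y)
    (hN_smul : ∀ (c : ℂ) (x), N (c • x) = ‖c‖ * N x)
    (hN_conj : ∀ x, N (fun i => (starRingEnd ℂ) (x i)) = N x)
    (G : Cd d → ℂ) (hG : Measurable G) (hGbd : ∀ w, ‖G w‖ ≤ 1) (z : Cd d) (hz : ‖z‖ < 1) :
    N (Dmap d n (bergman d σ G) z) ≤ maxC d n N * (Real.Gamma (lam + n) / Real.Gamma lam) *
      (cCoef d σ * ∫ w in unitBall d, ‖1 - herm z w‖ ^ (-(lam + n)) * (1 - ‖w‖ ^ 2) ^ σ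
        ∂(normVol d)) := by
  have hl : 0 < lam := by
    have : (0 : ℝ) < d := by exact_mod_cast hd
    linarith
  have hln : 0 < lam + n := by positivity
  have hΓ := Real.Gamma_pos_of_pos hl
  have hΓn := Real.Gamma_pos_of_pos hln
  have hc := cCoef_pos (d := d) hσ
  have hM : 0 ≤ maxC d n N := Real.iSup_nonneg fun _ => hN_nonneg _
  obtain ⟨l, hlx, hly⟩ := dual_vec N hN_nonneg hN_def hN_add hN_smul
    (Dmap d n (bergman d σ G) z)
  set ν := (normVol d).restrict (unitBall d) with hν
  have hrep := rep_bergman hd hσ hlam G hG hGbd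
  set g : Cd d → ℂ := fun w =>
    G w * ((cCoef d σ / Real.Gamma lam * (1 - ‖w‖ ^ 2) ^ σ : ℝ) : ℂ) with hg
  have hdec : ∀ x : MIdx d n → ℂ, l x = ∑ α, x α * l (Pi.single α 1) := by
    intro x
    have h1 : x = ∑ i, x i • (Pi.single i (1 : ℂ) : MIdx d n → ℂ) := by
      funext k; simp [Pi.single_apply]
    conv_lhs => rw [h1]
    simp [map_sum]
  have hδ : 0 < 1 - ‖z‖ := by linarith
  have hIntα : ∀ α : MIdx d n, Integrable (fun w => (Real.Gamma (lam + n) : ℂ) *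
      (1 - herm z w) ^ (-((lam + n : ℝ) : ℂ)) *
      ((starRingEnd ℂ) (Zmap d n w α) * g w)) ν := by
    intro α
    refine (rep_mpd hl hrep α).1.bdd_mul
      (c := ‖(Real.Gamma (lam + n) : ℂ)‖ * (1 - ‖z‖) ^ (-(lam + n)))
      ((kern_meas z _).const_mul _).aestronglyMeasurable ?_
    refine ae_ball fun w hw => ?_
    rw [norm_mul]
    gcongr
    exact kern_bound hw hδ hln le_rfl
  have hL : l (Dmap d n (bergman d σ G) z) = ∫ w, (Real.Gamma (lam + n) : ℂ) *
      (1 - herm z w) ^ (-((lam + n : ℝ) : ℂ)) * g w *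
        l (fun α => (starRingEnd ℂ) (Zmap d n w α)) ∂ν := by
    rw [hdec]
    have h1 : ∀ α : MIdx d n, Dmap d n (bergman d σ G) z α * l (Pi.single α 1) =
        ∫ w, (Real.Gamma (lam + n) : ℂ) *
      (1 - herm z w) ^ (-((lam + n : ℝ) : ℂ)) *
      ((starRingEnd ℂ) (Zmap d n w α) * g w) * l (Pi.single α 1) ∂ν := by
      intro α
      rw [integral_mul_const]
      congr 1
      exact (rep_mpd hl hrep α).2 z hz
    simp_rw [h1]
    rw [← integral_finsetSum _ fun α _ => (hIntα α).mul_const _]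
    congr 1
    funext w
    rw [hdec (fun α => (starRingEnd ℂ) (Zmap d n w α)), Finset.mul_sum]
    refine Finset.sum_congr rfl fun α _ => ?_
    ring
  have hN : N (Dmap d n (bergman d σ G) z) = ‖l (Dmap d n (bergman d σ G) z)‖ := by
    rw [hlx, Complex.norm_real, Real.norm_of_nonneg (hN_nonneg _)]
  have hwt := integrable_weight hd hσ
  have hIntR : Integrable (fun w => ‖1 - herm z w‖ ^ (-(lam + n)) * (1 - ‖w‖ ^ 2) ^ σ) ν := by
    refine Integrable.bdd_mul (c := (1 - ‖z‖) ^ (-(lam + n))) hwt ?_ ?_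
    · have := (kern_meas z (-((lam + n : ℝ) : ℂ))).norm
      refine (this.aestronglyMeasurable).congr (Filter.Eventually.of_forall fun w => ?_)
      simp only
      rw [← Complex.ofReal_neg, Complex.norm_cpow_real]
    · refine ae_ball fun w hw => ?_
      have := kern_bound (x := z) hw hδ hln le_rfl
      rw [← Complex.ofReal_neg, Complex.norm_cpow_real] at this
      rwa [Real.norm_of_nonneg (Real.rpow_nonneg (norm_nonneg _) _)]
  rw [hN, hL, ← integral_const_mul, ← integral_const_mul]
  refine norm_integral_le_of_norm_le ((hIntR.const_mul _).const_mul _) ?_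
  refine ae_ball fun w hw => ?_
  have hlZ : ‖l (fun α => (starRingEnd ℂ) (Zmap d n w α))‖ ≤ maxC d n N := by
    refine (hly _).trans ?_
    rw [hN_conj]
    exact maxC_bound hn N hN_nonneg hN_add hN_smul w hw
  have hw2 : 0 ≤ (1 - ‖w‖ ^ 2) ^ σ := by
    apply Real.rpow_nonneg
    nlinarith [norm_nonneg w]
  have hgw : ‖g w‖ ≤ cCoef d σ / Real.Gamma lam * (1 - ‖w‖ ^ 2) ^ σ := by
    simp only [hg]
    rw [norm_mul, Complex.norm_real, Real.norm_of_nonneg (by positivity)]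
    exact mul_le_of_le_one_left (by positivity) (hGbd w)
  rw [norm_mul, norm_mul, norm_mul, ← Complex.ofReal_neg, Complex.norm_cpow_real,
    Complex.norm_real, Real.norm_of_nonneg hΓn.le]
  calc _ ≤ Real.Gamma (lam + n) * ‖1 - herm z w‖ ^ (-(lam + n)) *
        (cCoef d σ / Real.Gamma lam * (1 - ‖w‖ ^ 2) ^ σ) * maxC d n N := by gcongr
    _ = _ := by field_simp


/-- Upper bound: for every measurable `G` with `‖G‖_∞ ≤ 1`, the Bloch seminorm of `T_σ G`
is at most `𝓒 · Γ(λ+n)Γ(n)/Γ((λ+n)/2)²`. -/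
theorem bloch_seminorm_bergman_le
    (d n : ℕ) (hd : 0 < d) (hn : 0 < n) (σ : ℝ) (hσ : -1 < σ)
    (lam : ℝ) (hlam : lam = d + 1 + σ)
    (N : (MIdx d n → ℂ) → ℝ)
    (hN_nonneg : ∀ x, 0 ≤ N x)
    (hN_def : ∀ x, N x = 0 → x = 0)
    (hN_add : ∀ x y, N (x + y) ≤ N x + N y)
    (hN_smul : ∀ (c : ℂ) (x), N (c • x) = ‖c‖ * N x)
    (hN_conj : ∀ x, N (fun i => (starRingEnd ℂ) (x i)) = N x)
    (G : Cd d → ℂ) (hG : Measurable G) (hGbd : ∀ w, ‖G w‖ ≤ 1) :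
    blochSemi d n N (bergman d σ G) ≤
      maxC d n N * (Real.Gamma (lam + n) * Real.Gamma n / Real.Gamma ((lam + n) / 2) ^ 2) := by
  have hl : 0 < lam := by
    have : (0 : ℝ) < d := by exact_mod_cast hd
    linarith
  have hn' : (0 : ℝ) < n := by exact_mod_cast hn
  have hΓ := Real.Gamma_pos_of_pos hl
  have hΓn := Real.Gamma_pos_of_pos (show 0 < lam + n by positivity)
  have hΓ0 := Real.Gamma_pos_of_pos hn'
  have hM : 0 ≤ maxC d n N := Real.iSup_nonneg fun _ => hN_nonneg _
  refine Real.iSup_le ?_ (by positivity)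
  rintro ⟨z, hz⟩
  have hz1 : ‖z‖ < 1 := by simpa [unitBall] using hz
  have h1 := point_bound d n hd hn σ hσ lam hlam N hN_nonneg hN_def hN_add hN_smul hN_conj
    G hG hGbd z hz1
  have h2 := key_ineq hd hn hσ z hz1 hlam
  have h3 : 0 ≤ (1 - ‖z‖ ^ 2) ^ n := by
    apply pow_nonneg
    nlinarith [norm_nonneg z]
  refine (mul_le_mul_of_nonneg_left h1 h3).trans ?_
  have h4 := mul_le_mul_of_nonneg_left h2
    (show 0 ≤ maxC d n N * (Real.Gamma (lam + n) / Real.Gamma lam) by positivity)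
  refine le_trans (le_of_eq (by ring)) (h4.trans (le_of_eq ?_))
  field_simp
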